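/- Let W ∈ ℝ^{n×n} be symmetric positive definite and T ∈ ℝ^{n×n} be symmetric positive semidefinite. Let λ ∈ ℂ and u = (x; y) ∈ ℂ^{2n} with u ≠ 0 satisfy 𝒜u = λ𝒢_α u, where 𝒜 = [[W, −T], [T, W]] and 𝒢_α = [[W, 0], [αI, W]] for some α ∈ ℝ. If y ≠ 0 and y*Ty = 0 (equivalently the Rayleigh quotient a = (y*Ty)/(y*y) vanishes), then λ = 1. -/

import Mathlib

open Matrix
open scoped ComplexOrder MatrixOrder

/-- A real positive semidefinite matrix stays positive semidefinite over `ℂ`. -/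
theorem Matrix.PosSemidef.map_complexOfReal {n : Type*} [Fintype n] {T : Matrix n n ℝ}
    (hT : T.PosSemidef) : (T.map Complex.ofReal).PosSemidef := by
  classical
  obtain ⟨B, rfl⟩ := CStarAlgebra.nonneg_iff_eq_star_mul_self.mp hT.nonneg
  have h : (star B * B).map Complex.ofReal = (B.map Complex.ofReal)ᴴ * B.map Complex.ofReal := by
    ext i j
    simp [Matrix.mul_apply]
  rw [h]
  exact Matrix.posSemidef_conjTranspose_mul_self _

/-- A real positive definite matrix has trivial kernel over `ℂ`. -/
theorem Matrix.PosDef.eq_zero_of_map_complexOfReal_mulVec_eq_zero {n : Type*} [Fintype n]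
    {W : Matrix n n ℝ} (hW : W.PosDef) {v : n → ℂ}
    (hv : W.map Complex.ofReal *ᵥ v = 0) : v = 0 := by
  classical
  refine Matrix.eq_zero_of_mulVec_eq_zero ?_ hv
  have h : (W.map Complex.ofReal).det = (W.det : ℂ) :=
    (Complex.ofRealHom.map_det W).symm
  rw [h]
  exact_mod_cast hW.det_pos.ne'

/-- If `(λ, (x; y))` is an eigenpair of `𝒢_α⁻¹𝒜` with `y ≠ 0` and
`y* T y = 0` (i.e. the Rayleigh quotient `a` vanishes), then `λ = 1`. -/
theorem blt_eigen_a_eq_zero {n : ℕ} (W T : Matrix (Fin n) (Fin n) ℝ)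
    (hW : W.PosDef) (hT : T.PosSemidef) (α : ℝ) (lam : ℂ) (x y : Fin n → ℂ)
    (hu : Sum.elim x y ≠ 0)
    (heig : Matrix.fromBlocks (W.map Complex.ofReal) (-(T.map Complex.ofReal))
        (T.map Complex.ofReal) (W.map Complex.ofReal) *ᵥ Sum.elim x y
      = lam • (Matrix.fromBlocks (W.map Complex.ofReal) 0 ((α : ℂ) • 1)
        (W.map Complex.ofReal) *ᵥ Sum.elim x y))
    (hy : y ≠ 0) (hTy : star y ⬝ᵥ (T.map Complex.ofReal *ᵥ y) = 0) :
    lam = 1 := by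
  have hTy0 : T.map Complex.ofReal *ᵥ y = 0 :=
    (hT.map_complexOfReal.dotProduct_mulVec_zero_iff y).mp hTy
  by_contra hlam
  have eq_zero_of_fixed {v : Fin n → ℂ}
      (h : W.map Complex.ofReal *ᵥ v = lam • (W.map Complex.ofReal *ᵥ v)) : v = 0 := by
    refine hW.eq_zero_of_map_complexOfReal_mulVec_eq_zero ?_
    have h' : (1 - lam) • (W.map Complex.ofReal *ᵥ v) = 0 := by
      rw [sub_smul, one_smul, ← h, sub_self]
    exact (smul_eq_zero.mp h').resolve_left (sub_ne_zero.mpr (Ne.symm hlam))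
  rw [Matrix.fromBlocks_mulVec, Matrix.fromBlocks_mulVec] at heig
  have hx : x = 0 := eq_zero_of_fixed <| by
    funext i
    simpa [Matrix.neg_mulVec, hTy0] using congrFun heig (Sum.inl i)
  refine hy (eq_zero_of_fixed ?_)
  funext i
  simpa [hx] using congrFun heig (Sum.inr i)
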